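/- For every integer i ≥ 3, every integer j with 2 ≤ j ≤ i−1, and every real number a with a ≥ i, consecutive coefficients in the expansions of t_{i0} and t_i satisfy the ratio bounds |d_{i,j+1}| < a²·|d_{i,j}| and |e_{i,j+1}| < a²·|e_{i,j}|, where d_{i,j} and e_{i,j} are the coefficients of a^{−(2j+1)} in t_{i0} and t_i respectively. -/

import Mathlib

open Polynomial in
/-- The pair `(D, E)` of polynomials in `x = a⁻²` with `t_{i0} = a⁻¹ D(a⁻²)` and
`t_i = a⁻¹ E(a⁻²)`. -/
noncomputable def groverPoly : ℕ → ℝ[X] × ℝ[X]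
  | 0 => (1, 1)
  | i + 1 =>
    ((groverPoly i).1 + 2 * (groverPoly i).2 - X * (2 * ((groverPoly i).1 + (groverPoly i).2)),
      (groverPoly i).2 - X * (2 * ((groverPoly i).1 + (groverPoly i).2)))

theorem choose_add_succ_mul (i j : ℕ) :
    ((i + j + 1).choose (2 * j + 1) : ℝ) * (2 * j + 1) =
      (i + j + 1) * ((i + j).choose (2 * j) : ℝ) := by
  exact_mod_cast (Nat.add_one_mul_choose_eq (i + j) (2 * j)).symm

theorem choose_add_succ_succ_mul (i j : ℕ) :
    ((i + j + 1).choose (2 * j + 2) : ℝ) * (2 * j + 2) =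
      ((i + j + 1).choose (2 * j + 1) : ℝ) * (i - j) := by
  rcases le_or_gt j i with h | h
  · have := Nat.choose_succ_right_eq (i + j + 1) (2 * j + 1)
    rw [show i + j + 1 - (2 * j + 1) = i - j by omega] at this
    rw [← Nat.cast_sub h]
    exact_mod_cast this
  · rw [Nat.choose_eq_zero_of_lt (show i + j + 1 < 2 * j + 2 by omega),
      Nat.choose_eq_zero_of_lt (show i + j + 1 < 2 * j + 1 by omega)]
    simp

theorem groverPoly_coeff (i : ℕ) : ∀ j : ℕ,
    (groverPoly i).1.coeff j =
        (-4) ^ j * ((2 * i + 1) / (2 * j + 1)) * ((i + j).choose (2 * j) : ℝ) ∧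
      (groverPoly i).2.coeff j = (-4) ^ j * ((i + j).choose (2 * j) : ℝ) := by
  induction i with
  | zero =>
    rintro (_ | j)
    · simp [groverPoly]
    · have : (j + 1).choose (2 * (j + 1)) = 0 := Nat.choose_eq_zero_of_lt (by omega)
      simp [groverPoly, Polynomial.coeff_one, this]
  | succ i ih =>
    rintro (_ | j)
    · have h := ih 0
      simp only [groverPoly, Polynomial.coeff_sub, Polynomial.coeff_add,
        Polynomial.coeff_ofNat_mul, Polynomial.coeff_X_mul_zero, h.1, h.2]
      constructor <;> simp
      ring
    · have h := ih j
      have h' := ih (j + 1)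
      simp only [groverPoly, Polynomial.coeff_sub, Polynomial.coeff_add,
        Polynomial.coeff_ofNat_mul, Polynomial.coeff_X_mul, h.1, h.2, h'.1, h'.2]
      have p₁ := choose_add_succ_mul i j
      have p₂ := choose_add_succ_succ_mul i j
      rw [show i + 1 + (j + 1) = i + j + 1 + 1 by ring, show 2 * (j + 1) = 2 * j + 1 + 1 by ring,
        Nat.choose_succ_succ (i + j + 1), show i + (j + 1) = i + j + 1 by ring]
      push_cast
      have hj : (0 : ℝ) < 2 * j + 1 := by positivity
      have hj3 : (2 * ((j : ℝ) + 1) + 1) ≠ 0 := by positivity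
      generalize ((i + j + 1).choose (2 * j + 1 + 1) : ℝ) = A at *
      generalize ((i + j + 1).choose (2 * j + 1) : ℝ) = C at *
      generalize ((i + j).choose (2 * j) : ℝ) = B at *
      have hB : (2 * (i : ℝ) + 1) / (2 * j + 1) * B + B = 2 * C := by
        field_simp
        linear_combination -2 * p₁
      constructor
      · have hA : (2 * (i : ℝ) + 1) / (2 * (j + 1) + 1) * A + 2 * A + C =
            (2 * (i + 1) + 1) / (2 * (j + 1) + 1) * (C + A) := by
          field_simp
          linear_combination 2 * p₂
        linear_combination (-4) ^ (j + 1) * hA - 2 * (-4) ^ j * hB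
      · linear_combination - 2 * (-4) ^ j * hB

theorem eval_groverPoly {b : ℝ} {t t0 : ℕ → ℝ}
    (ht : t 0 = 1 / b) (ht0 : t0 0 = 1 / b)
    (hrec0 : ∀ i, t0 (i + 1) = -2 * t0 i / b ^ 2 - 2 * t i / b ^ 2 + 2 * t i + t0 i)
    (hrec : ∀ i, t (i + 1) = -2 * t0 i / b ^ 2 - 2 * t i / b ^ 2 + t i) (i : ℕ) :
    t0 i = b⁻¹ * (groverPoly i).1.eval (b ^ 2)⁻¹ ∧
      t i = b⁻¹ * (groverPoly i).2.eval (b ^ 2)⁻¹ := by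
  induction i with
  | zero => simp [groverPoly, ht, ht0]
  | succ i ih =>
    rw [hrec0, hrec, ih.1, ih.2]
    constructor <;> simp [groverPoly] <;> ring

theorem coeff_eq_of_odd_inverse_power_expansion (P : Polynomial ℝ) (n : ℕ) (c : ℕ → ℝ)
    (h : ∀ b : ℝ, b ≠ 0 → b⁻¹ * P.eval (b ^ 2)⁻¹ =
      ∑ j ∈ Finset.range (n + 1), c j * b ^ (-(2 * (j : ℤ) + 1)))
    {j : ℕ} (hj : j ≤ n) : c j = P.coeff j := by
  have key : P = ∑ k ∈ Finset.range (n + 1), Polynomial.monomial k (c k) := by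
    refine Polynomial.eq_of_infinite_eval_eq _ _ ((Set.Ioi_infinite (0 : ℝ)).mono fun x hx => ?_)
    have hx : 0 < x := hx
    have hs : 0 < √x := Real.sqrt_pos.2 hx
    have hb := h (√x)⁻¹ (by positivity)
    rw [inv_pow, Real.sq_sqrt hx.le, inv_inv, inv_inv] at hb
    refine mul_left_cancel₀ hs.ne' (hb.trans ?_)
    rw [Polynomial.eval_finsetSum, Finset.mul_sum]
    refine Finset.sum_congr rfl fun k _ => ?_
    have hpow : (√x)⁻¹ ^ (-(2 * (k : ℤ) + 1)) = √x * x ^ k := by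
      rw [inv_zpow', neg_neg, zpow_add₀ hs.ne', zpow_mul, zpow_one, mul_comm]
      congr 1
      rw [zpow_natCast, zpow_ofNat, Real.sq_sqrt hx.le]
    rw [hpow, Polynomial.eval_monomial]
    ring
  rw [key, Polynomial.finsetSum_coeff]
  simp [Polynomial.coeff_monomial, Nat.lt_succ_of_le hj]

theorem choose_succ_lt_sq_mul_choose {i j : ℕ} (hj : 2 ≤ j) (hji : j < i) {a : ℝ}
    (ha : (i : ℝ) ≤ a) :
    4 * ((i + j + 1).choose (2 * j + 2) : ℝ) < a ^ 2 * ((i + j).choose (2 * j) : ℝ) := by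
  have p₁ := choose_add_succ_mul i j
  have p₂ := choose_add_succ_succ_mul i j
  have hB : (0 : ℝ) < (i + j).choose (2 * j) := by
    exact_mod_cast Nat.choose_pos (show 2 * j ≤ i + j by omega)
  have hj' : (2 : ℝ) ≤ j := by exact_mod_cast hj
  have hi' : (j : ℝ) < i := by exact_mod_cast hji
  have hratio : 4 * ((i : ℝ) + j + 1) * (i - j) < a ^ 2 * ((2 * j + 2) * (2 * j + 1)) := by
    have h₁ : (i : ℝ) ^ 2 ≤ a ^ 2 := by gcongr
    have h₂ : (30 : ℝ) ≤ (2 * j + 2) * (2 * j + 1) := by nlinarith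
    have h₃ : a ^ 2 * 30 ≤ a ^ 2 * ((2 * j + 2) * (2 * j + 1)) := by gcongr
    nlinarith
  refine lt_of_mul_lt_mul_right ?_ (show (0 : ℝ) ≤ (2 * j + 2) * (2 * j + 1) by positivity)
  calc 4 * ((i + j + 1).choose (2 * j + 2) : ℝ) * ((2 * j + 2) * (2 * j + 1))
      = 4 * ((i : ℝ) + j + 1) * (i - j) * ((i + j).choose (2 * j) : ℝ) := by
        linear_combination 4 * (2 * (j : ℝ) + 1) * p₂ + 4 * ((i : ℝ) - j) * p₁
    _ < a ^ 2 * ((2 * j + 2) * (2 * j + 1)) * ((i + j).choose (2 * j) : ℝ) := by gcongr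
    _ = _ := by ring


/-- Lemma 4 of the paper: for `i ≥ 3`, `2 ≤ j ≤ i - 1` and real
`a ≥ i`, consecutive coefficients in the expansions of `t_{i0}` and `t_i`
satisfy `|d_{i,j+1}| < a² |d_{i,j}|` and `|e_{i,j+1}| < a² |e_{i,j}|`. -/
theorem grover_consecutive_coefficient_ratio
    (T T0 : ℝ → ℕ → ℝ)
    (hinit : ∀ a : ℝ, a ≠ 0 → T a 0 = 1 / a ∧ T0 a 0 = 1 / a)
    (hrec0 : ∀ a : ℝ, a ≠ 0 → ∀ i,
      T0 a (i + 1) = -2 * T0 a i / a ^ 2 - 2 * T a i / a ^ 2 + 2 * T a i + T0 a i)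
    (hrec : ∀ a : ℝ, a ≠ 0 → ∀ i,
      T a (i + 1) = -2 * T0 a i / a ^ 2 - 2 * T a i / a ^ 2 + T a i)
    (i : ℕ) (hi : 3 ≤ i)
    (d e : ℕ → ℚ)
    (hd : ∀ b : ℝ, b ≠ 0 →
      T0 b i = ∑ j ∈ Finset.range (i + 1), (d j : ℝ) * b ^ (-(2 * (j : ℤ) + 1)))
    (he : ∀ b : ℝ, b ≠ 0 →
      T b i = ∑ j ∈ Finset.range (i + 1), (e j : ℝ) * b ^ (-(2 * (j : ℤ) + 1)))
    (j : ℕ) (hj2 : 2 ≤ j) (hji : j ≤ i - 1)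
    (a : ℝ) (hai : (i : ℝ) ≤ a) :
    |(d (j + 1) : ℝ)| < a ^ 2 * |(d j : ℝ)| ∧
      |(e (j + 1) : ℝ)| < a ^ 2 * |(e j : ℝ)| := by
  have hT b (hb : b ≠ 0) :=
    eval_groverPoly (hinit b hb).1 (hinit b hb).2 (hrec0 b hb) (hrec b hb) i
  have hd' {k : ℕ} (hk : k ≤ i) : (d k : ℝ) = (groverPoly i).1.coeff k :=
    coeff_eq_of_odd_inverse_power_expansion _ i (fun k => (d k : ℝ))
      (fun b hb => (hT b hb).1.symm.trans (hd b hb)) hk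
  have he' {k : ℕ} (hk : k ≤ i) : (e k : ℝ) = (groverPoly i).2.coeff k :=
    coeff_eq_of_odd_inverse_power_expansion _ i (fun k => (e k : ℝ))
      (fun b hb => (hT b hb).2.symm.trans (he b hb)) hk
  have hlt : j < i := by omega
  have hchoose := choose_succ_lt_sq_mul_choose hj2 hlt hai
  rw [hd' hlt, hd' hlt.le, he' hlt, he' hlt.le, (groverPoly_coeff i _).1, (groverPoly_coeff i _).1,
    (groverPoly_coeff i _).2, (groverPoly_coeff i _).2, show i + (j + 1) = i + j + 1 by ring,
    show 2 * (j + 1) = 2 * j + 2 by ring]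
  simp only [abs_mul, abs_pow, abs_neg, Nat.abs_cast, Nat.abs_ofNat]
  have hq (k : ℕ) : |(2 * (i : ℝ) + 1) / (2 * (k : ℝ) + 1)| = (2 * i + 1) / (2 * k + 1) :=
    abs_of_pos (by positivity)
  rw [hq, hq]
  constructor
  · calc (4 : ℝ) ^ (j + 1) * ((2 * i + 1) / (2 * (j + 1 : ℕ) + 1)) *
          ((i + j + 1).choose (2 * j + 2) : ℝ)
        ≤ 4 ^ (j + 1) * ((2 * i + 1) / (2 * j + 1)) * ((i + j + 1).choose (2 * j + 2) : ℝ) := by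
          gcongr
          omega
      _ = 4 ^ j * ((2 * i + 1) / (2 * j + 1)) * (4 * ((i + j + 1).choose (2 * j + 2) : ℝ)) := by
          ring
      _ < 4 ^ j * ((2 * i + 1) / (2 * j + 1)) * (a ^ 2 * ((i + j).choose (2 * j) : ℝ)) := by
          gcongr
      _ = _ := by ring
  · calc (4 : ℝ) ^ (j + 1) * ((i + j + 1).choose (2 * j + 2) : ℝ)
        = 4 ^ j * (4 * ((i + j + 1).choose (2 * j + 2) : ℝ)) := by ring
      _ < 4 ^ j * (a ^ 2 * ((i + j).choose (2 * j) : ℝ)) := by gcongr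
      _ = _ := by ring
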